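/- arXiv:2512.08840 — 3 statements merged into one kernel-verified Lean document; each statement's English description precedes it below -/
import Mathlib

section
/- For every continuously differentiable, compactly supported function u : ℝ → ℝ, the quadratic form of the linearized operator L₊ is nonnegative: ∫_ℝ [ (u'(x))² + (1 - 12 φ(x)² + 15 φ(x)⁴) u(x)² ] dx ≥ 0. -/
open Real MeasureTheory

noncomputable def φ (x : ℝ) : ℝ := Real.sqrt ((1 + Real.tanh x) / 2)

lemma tanh_hasDerivAt_aux (x : ℝ) : HasDerivAt Real.tanh (1 - Real.tanh x ^ 2) x := by
  have hc : Real.cosh x ≠ 0 := (Real.cosh_pos x).ne'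
  have h := (Real.hasDerivAt_sinh x).div (Real.hasDerivAt_cosh x) hc
  have e : Real.tanh = Real.sinh / Real.cosh := by
    funext y; simp [Real.tanh_eq_sinh_div_cosh]
  have e2 : (Real.cosh x * Real.cosh x - Real.sinh x * Real.sinh x) / Real.cosh x ^ 2
      = 1 - Real.tanh x ^ 2 := by
    rw [Real.tanh_eq_sinh_div_cosh]
    field_simp
  rw [e2, ← e] at h
  exact h

lemma phi_sq_aux (x : ℝ) : (φ x) ^ 2 = (1 + Real.tanh x) / 2 := by
  unfold φ
  apply Real.sq_sqrt
  have := Real.neg_one_lt_tanh x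
  linarith

theorem Lplus_quadratic_form_nonneg (u : ℝ → ℝ)
    (hu : ContDiff ℝ 1 u) (hsupp : HasCompactSupport u) :
    0 ≤ ∫ x : ℝ,
      ((deriv u x) ^ 2 + (1 - 12 * (φ x) ^ 2 + 15 * (φ x) ^ 4) * (u x) ^ 2) := by
  have hcu : Continuous u := hu.continuous
  have hcd : Continuous (deriv u) := hu.continuous_deriv le_rfl
  have hct : Continuous Real.tanh :=
    continuous_iff_continuousAt.2 fun x => (tanh_hasDerivAt_aux x).continuousAt
  have hsd : HasCompactSupport (deriv u) := hsupp.deriv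
  let w : ℝ → ℝ := fun x => 1 - 3 * ((1 + Real.tanh x) / 2)
  have hw : ∀ x, HasDerivAt w (-(3 * ((1 - Real.tanh x ^ 2) / 2))) x := fun x => by
    have := ((((tanh_hasDerivAt_aux x).const_add 1).div_const 2).const_mul 3).const_sub 1
    exact this
  have hcw : Continuous w := continuous_iff_continuousAt.2 fun x => (hw x).continuousAt
  let g : ℝ → ℝ := fun x => w x * (u x * u x)
  let g' : ℝ → ℝ := fun x => -(3 * ((1 - Real.tanh x ^ 2) / 2)) * (u x * u x)
      + w x * (deriv u x * u x + u x * deriv u x)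
  have hg : ∀ x, HasDerivAt g (g' x) x := fun x => by
    have h1 : HasDerivAt u (deriv u x) x := (hu.differentiable one_ne_zero x).hasDerivAt
    exact (hw x).mul (h1.mul h1)
  have hzero : ∀ f : ℝ → ℝ, Continuous f → (∀ x, u x = 0 → deriv u x = 0 → f x = 0) →
      Integrable f := fun f hf h0 => by
    refine hf.integrable_of_hasCompactSupport (hsupp.mono' ?_)
    intro x hx
    by_contra hxt
    refine hx (h0 x (image_eq_zero_of_notMem_tsupport hxt) ?_)
    by_contra hd
    exact hxt (support_deriv_subset hd)
  have hgi : Integrable g := hzero g (by fun_prop) (fun x h _ => by simp [g, h])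
  have hgi' : Integrable g' := hzero g' (by fun_prop) (fun x h h' => by simp [g', h])
  have hqi : Integrable (fun x => (deriv u x - w x * u x) ^ 2) :=
    hzero _ (by fun_prop) (fun x h h' => by simp [h, h'])
  have hI : ∫ x, g' x = 0 := integral_eq_zero_of_hasDerivAt_of_integrable hg hgi' hgi
  have key : (fun x : ℝ =>
      ((deriv u x) ^ 2 + (1 - 12 * (φ x) ^ 2 + 15 * (φ x) ^ 4) * (u x) ^ 2)) =
      fun x => (deriv u x - w x * u x) ^ 2 + g' x := by
    funext x
    have e : φ x ^ 4 = ((1 + Real.tanh x) / 2) ^ 2 := by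
      rw [← phi_sq_aux]; ring
    rw [e, phi_sq_aux]
    simp only [g', w]
    ring
  rw [key, integral_add hqi hgi', hI, add_zero]
  exact integral_nonneg fun x => sq_nonneg _
end

section
/- Let u, v : ℝ → ℝ be continuously differentiable with compact support, and set η(x) = 2 φ(x) u(x) + u(x)² + v(x)². Then E(φ + u + i v) and E(φ) are both finite and E(φ + u + i v) - E(φ) = ∫_ℝ [ (u'(x))² + (v'(x))² + (1 - φ(x)²)(1 - 3 φ(x)²)(u(x)² + v(x)²) + (3 φ(x)² - 2) η(x)² + η(x)³ ] dx. -/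
open Real MeasureTheory

/-- Energy density of the cubic–quintic NLS equation. -/
noncomputable def energyDensity (ψ : ℝ → ℂ) (x : ℝ) : ℝ :=
  ‖deriv ψ x‖ ^ 2 + ‖ψ x‖ ^ 2 * (1 - ‖ψ x‖ ^ 2) ^ 2

theorem phi_sq (x : ℝ) : φ x ^ 2 = (1 + Real.tanh x) / 2 := by
  unfold φ
  have := Real.neg_one_lt_tanh x
  rw [Real.sq_sqrt (by linarith)]

theorem phi_pos (x : ℝ) : 0 < φ x := by
  unfold φ
  have := Real.neg_one_lt_tanh x
  exact Real.sqrt_pos.mpr (by linarith)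

theorem phi_hasDerivAt (x : ℝ) : HasDerivAt φ (φ x * (1 - φ x ^ 2)) x := by
  have hc := Real.cosh_pos x
  have ht : HasDerivAt Real.tanh (1 - Real.tanh x ^ 2) x := by
    have h := (Real.hasDerivAt_sinh x).div (Real.hasDerivAt_cosh x) hc.ne'
    have he : Real.tanh = Real.sinh / Real.cosh := by
      funext y; simp [Real.tanh_eq_sinh_div_cosh]
    rw [he]
    refine h.congr_deriv ?_
    rw [Pi.div_apply]
    field_simp
  have h0 := Real.neg_one_lt_tanh x
  have h1 : HasDerivAt (fun y => Real.sqrt ((1 + Real.tanh y) / 2)) _ x :=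
    ((ht.const_add 1).div_const 2).sqrt (by linarith : (0:ℝ) < (1 + Real.tanh x) / 2).ne'
  have hp := phi_pos x
  have hs := phi_sq x
  have e : Real.sqrt ((1 + Real.tanh x) / 2) = φ x := rfl
  rw [e] at h1
  have hf : φ = fun y => Real.sqrt ((1 + Real.tanh y) / 2) := rfl
  rw [show φ x * (1 - φ x ^ 2) = (1 - Real.tanh x ^ 2) / 2 / (2 * φ x) by
    have : Real.tanh x = 2 * φ x ^ 2 - 1 := by linarith
    rw [this]; field_simp; ring]
  exact h1

theorem phi_dens_bound (x : ℝ) : φ x ^ 2 * (1 - φ x ^ 2) ≤ (1 + x ^ 2)⁻¹ := by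
  have hc := Real.cosh_pos x
  have h2 : x ^ 2 ≤ Real.sinh x ^ 2 := by
    rcases le_total 0 x with h | h
    · have := Real.self_le_sinh_iff.mpr h
      nlinarith
    · have := Real.sinh_le_self_iff.mpr h
      nlinarith
  have h3 := Real.cosh_sq x
  rw [phi_sq, Real.tanh_eq_sinh_div_cosh]
  have : (1 + Real.sinh x / Real.cosh x) / 2 * (1 - (1 + Real.sinh x / Real.cosh x) / 2)
      = (4 * Real.cosh x ^ 2)⁻¹ := by
    field_simp
    linarith
  rw [this]
  apply inv_anti₀ (by positivity)
  nlinarith [sq_nonneg x]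

theorem phi_lt_one (x : ℝ) : φ x ^ 2 < 1 := by
  rw [phi_sq]
  have := Real.tanh_lt_one x
  linarith

theorem phi_cont : Continuous φ :=
  continuous_iff_continuousAt.mpr fun x => (phi_hasDerivAt x).continuousAt

theorem dens_phi (x : ℝ) : energyDensity (fun x => (φ x : ℂ)) x
    = 2 * (φ x ^ 2 * (1 - φ x ^ 2) ^ 2) := by
  unfold energyDensity
  rw [(phi_hasDerivAt x).ofReal_comp.deriv]
  simp only [Complex.norm_real, Real.norm_eq_abs, sq_abs]
  ring

theorem dens_pert (u v : ℝ → ℝ) (hu : ContDiff ℝ 1 u) (hv : ContDiff ℝ 1 v) (x : ℝ) :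
    energyDensity (fun x => (φ x : ℂ) + (u x : ℂ) + (v x : ℂ) * Complex.I) x
    = (φ x * (1 - φ x ^ 2) + deriv u x) ^ 2 + deriv v x ^ 2 +
      ((φ x + u x) ^ 2 + v x ^ 2) * (1 - ((φ x + u x) ^ 2 + v x ^ 2)) ^ 2 := by
  have n (a b c : ℝ) : ‖(a : ℂ) + b + c * Complex.I‖ ^ 2 = (a + b) ^ 2 + c ^ 2 := by
    rw [← Complex.normSq_eq_norm_sq, Complex.normSq_apply]
    simp
    ring
  have du := (hu.differentiable one_ne_zero x).hasDerivAt.ofReal_comp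
  have dv := (hv.differentiable one_ne_zero x).hasDerivAt.ofReal_comp
  unfold energyDensity
  have hd : HasDerivAt (fun x => (φ x : ℂ) + (u x : ℂ) + (v x : ℂ) * Complex.I) _ x :=
    ((phi_hasDerivAt x).ofReal_comp.add du).add (dv.mul_const Complex.I)
  rw [hd.deriv, n, n]

theorem phi_int : Integrable (energyDensity (fun x => (φ x : ℂ))) := by
  have h : energyDensity (fun x => (φ x : ℂ)) = fun x => 2 * (φ x ^ 2 * (1 - φ x ^ 2) ^ 2) :=
    funext dens_phi
  rw [h]
  have hc := phi_cont
  refine (integrable_inv_one_add_sq.const_mul 2).mono'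
    (by fun_prop : Continuous _).aestronglyMeasurable (Filter.Eventually.of_forall fun x => ?_)
  rw [Real.norm_of_nonneg (by positivity)]
  have h1 := phi_dens_bound x
  have h2 := phi_lt_one x
  have h3 := sq_nonneg (φ x)
  have h4 : 0 ≤ φ x ^ 2 * (1 - φ x ^ 2) := mul_nonneg h3 (by linarith)
  nlinarith [mul_nonneg h4 h3]

theorem energy_expansion (u v : ℝ → ℝ)
    (hu : ContDiff ℝ 1 u) (hus : HasCompactSupport u)
    (hv : ContDiff ℝ 1 v) (hvs : HasCompactSupport v)
    (η : ℝ → ℝ) (hη : ∀ x, η x = 2 * φ x * u x + (u x) ^ 2 + (v x) ^ 2) :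
    Integrable (energyDensity (fun x => (φ x : ℂ) + (u x : ℂ) + (v x : ℂ) * Complex.I)) ∧
    Integrable (energyDensity (fun x => (φ x : ℂ))) ∧
    (∫ x : ℝ, energyDensity (fun x => (φ x : ℂ) + (u x : ℂ) + (v x : ℂ) * Complex.I) x) -
      (∫ x : ℝ, energyDensity (fun x => (φ x : ℂ)) x) =
    ∫ x : ℝ,
      ((deriv u x) ^ 2 + (deriv v x) ^ 2 +
        (1 - (φ x) ^ 2) * (1 - 3 * (φ x) ^ 2) * ((u x) ^ 2 + (v x) ^ 2) +
        (3 * (φ x) ^ 2 - 2) * (η x) ^ 2 + (η x) ^ 3) := by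
  have hpc := phi_cont
  have huc := hu.continuous
  have hvc := hv.continuous
  have hduc := hu.continuous_deriv le_rfl
  have hdvc := hv.continuous_deriv le_rfl
  set g : ℝ → ℝ := fun x => 2 * (φ x * (1 - φ x ^ 2)) * u x with hg
  set g' : ℝ → ℝ := fun x => 2 * ((1 - 3 * φ x ^ 2) * (φ x * (1 - φ x ^ 2))) * u x
    + 2 * (φ x * (1 - φ x ^ 2)) * deriv u x with hg'
  set R : ℝ → ℝ := fun x => (deriv u x) ^ 2 + (deriv v x) ^ 2 +
        (1 - (φ x) ^ 2) * (1 - 3 * (φ x) ^ 2) * ((u x) ^ 2 + (v x) ^ 2) +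
        (3 * (φ x) ^ 2 - 2) * (η x) ^ 2 + (η x) ^ 3 with hR
  have hηc : Continuous η := by
    rw [funext hη]; fun_prop
  have hder : ∀ x, HasDerivAt g (g' x) x := by
    intro x
    have hp := phi_hasDerivAt x
    have := ((hp.mul ((hp.pow 2).const_sub 1)).const_mul 2).mul
      (hu.differentiable one_ne_zero x).hasDerivAt
    refine HasDerivAt.congr_deriv (f := g) this ?_
    simp only [hg', Pi.mul_apply, Pi.pow_apply]
    push_cast
    ring
  have hK : IsCompact (tsupport u ∪ tsupport v) := hus.isCompact.union hvs.isCompact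
  have hz : ∀ x ∉ tsupport u ∪ tsupport v, u x = 0 ∧ v x = 0 ∧ deriv u x = 0 ∧ deriv v x = 0 := by
    intro x hx
    simp only [Set.mem_union, not_or] at hx
    refine ⟨image_eq_zero_of_notMem_tsupport hx.1, image_eq_zero_of_notMem_tsupport hx.2, ?_, ?_⟩
    · by_contra h
      exact hx.1 (support_deriv_subset h)
    · by_contra h
      exact hx.2 (support_deriv_subset h)
  have ig : Integrable g := by
    refine Continuous.integrable_of_hasCompactSupport (by fun_prop) (.intro hK fun x hx => ?_)
    simp [hg, hz x hx]
  have ig' : Integrable g' := by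
    refine Continuous.integrable_of_hasCompactSupport (by fun_prop) (.intro hK fun x hx => ?_)
    simp [hg', hz x hx]
  have iR : Integrable R := by
    refine Continuous.integrable_of_hasCompactSupport (by fun_prop) (.intro hK fun x hx => ?_)
    simp [hR, hη, hz x hx]
  have i0 := integral_eq_zero_of_hasDerivAt_of_integrable hder ig' ig
  have key : energyDensity (fun x => (φ x : ℂ) + (u x : ℂ) + (v x : ℂ) * Complex.I)
      = fun x => energyDensity (fun x => (φ x : ℂ)) x + (R x + g' x) := by
    funext x
    rw [dens_pert u v hu hv, dens_phi]
    simp only [hR, hg', hη]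
    ring
  have iRg : Integrable (fun x => R x + g' x) := iR.add ig'
  refine ⟨?_, phi_int, ?_⟩
  · rw [key]; exact phi_int.add iRg
  · rw [key, integral_add phi_int iRg, integral_add iR ig', i0]
    ring
end

section
/- The kink has finite energy, and its value is E(φ) = ∫_ℝ [ (φ'(x))² + φ(x)² (1 - φ(x)²)² ] dx = 1/2. -/
open Real MeasureTheory

/-- The square of the kink, in logistic form. -/
noncomputable def kinkU (x : ℝ) : ℝ := 1 - (1 + Real.exp (2 * x))⁻¹

lemma kinkU_eq (x : ℝ) : (1 + Real.tanh x) / 2 = kinkU x := by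
  have h : Real.exp (2 * x) = Real.exp x * Real.exp x := by
    rw [← Real.exp_add]; ring_nf
  have hx := Real.exp_pos x
  rw [kinkU, Real.tanh_eq, h, Real.exp_neg]
  field_simp
  ring

lemma kinkU_pos (x : ℝ) : 0 < kinkU x := by
  have hx := Real.exp_pos (2 * x)
  have : (1 + Real.exp (2 * x))⁻¹ < 1 := inv_lt_one_of_one_lt₀ (by linarith)
  unfold kinkU; linarith

lemma kinkU_hasDerivAt (x : ℝ) :
    HasDerivAt kinkU (2 * kinkU x * (1 - kinkU x)) x := by
  have hx := Real.exp_pos (2 * x)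
  have h1 : HasDerivAt (fun y : ℝ => 1 + Real.exp (2 * y)) (Real.exp (2 * x) * (2 * 1)) x :=
    (((hasDerivAt_id x).const_mul 2).exp).const_add 1
  have h2 := (h1.inv (by positivity)).const_sub 1
  refine h2.congr_deriv ?_
  unfold kinkU
  field_simp
  ring

lemma phi_eq : φ = fun x => Real.sqrt (kinkU x) := by
  funext x; rw [φ, kinkU_eq]

lemma density_eq (x : ℝ) :
    (deriv φ x) ^ 2 + (φ x) ^ 2 * (1 - (φ x) ^ 2) ^ 2 = 2 * kinkU x * (1 - kinkU x) ^ 2 := by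
  have hp := kinkU_pos x
  have hd := ((kinkU_hasDerivAt x).sqrt hp.ne').deriv
  rw [phi_eq, hd, div_pow, mul_pow 2 (Real.sqrt _), Real.sq_sqrt hp.le]
  field_simp
  ring

lemma prim_hasDerivAt (x : ℝ) :
    HasDerivAt (fun y => kinkU y - kinkU y ^ 2 / 2) (2 * kinkU x * (1 - kinkU x) ^ 2) x := by
  have h := kinkU_hasDerivAt x
  refine (h.sub ((h.pow 2).div_const 2)).congr_deriv ?_
  simp
  ring

lemma kinkU_top : Filter.Tendsto kinkU Filter.atTop (nhds 1) := by
  have h1 : Filter.Tendsto (fun x : ℝ => 1 + Real.exp (2 * x)) Filter.atTop Filter.atTop :=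
    Filter.tendsto_atTop_add_const_left _ _
      (Real.tendsto_exp_atTop.comp (Filter.tendsto_id.const_mul_atTop (by norm_num)))
  have h2 := h1.inv_tendsto_atTop.const_sub 1
  simp only [sub_zero] at h2
  exact h2

lemma kinkU_bot : Filter.Tendsto kinkU Filter.atBot (nhds 0) := by
  have h1 : Filter.Tendsto (fun x : ℝ => Real.exp (2 * x)) Filter.atBot (nhds 0) :=
    Real.tendsto_exp_atBot.comp (Filter.tendsto_id.const_mul_atBot (by norm_num))
  have h2 := ((h1.const_add 1).inv₀ (by norm_num)).const_sub 1
  norm_num at h2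
  exact h2

lemma prim_top :
    Filter.Tendsto (fun y => kinkU y - kinkU y ^ 2 / 2) Filter.atTop (nhds (1 / 2)) := by
  have h := kinkU_top.sub ((kinkU_top.pow 2).div_const 2)
  norm_num at h ⊢
  exact h

lemma prim_bot :
    Filter.Tendsto (fun y => kinkU y - kinkU y ^ 2 / 2) Filter.atBot (nhds 0) := by
  have h := kinkU_bot.sub ((kinkU_bot.pow 2).div_const 2)
  norm_num at h
  exact h

lemma density_integrable : Integrable (fun x => 2 * kinkU x * (1 - kinkU x) ^ 2) := by
  have hnn : ∀ x, 0 ≤ 2 * kinkU x * (1 - kinkU x) ^ 2 := fun x => by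
    have := kinkU_pos x
    positivity
  rw [← integrableOn_univ, ← Set.Iio_union_Ici (a := (0 : ℝ))]
  refine IntegrableOn.union ?_ ?_
  · have h : IntegrableOn ((fun x => 2 * kinkU x * (1 - kinkU x) ^ 2) ∘ fun x => -x)
        (Set.Ioi (0 : ℝ)) := by
      refine integrableOn_Ioi_deriv_of_nonneg'
        (g := fun x => -(kinkU (-x) - kinkU (-x) ^ 2 / 2)) (l := -0) ?_ (fun x _ => hnn _) ?_
      · intro x _
        have := ((prim_hasDerivAt (-x)).comp x (hasDerivAt_neg x)).neg
        refine this.congr_deriv ?_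
        simp
      · exact (prim_bot.comp Filter.tendsto_neg_atTop_atBot).neg
    have e := (Measure.measurePreserving_neg (volume : Measure ℝ)).integrableOn_comp_preimage
      (Homeomorph.neg ℝ).measurableEmbedding
      (f := fun x => 2 * kinkU x * (1 - kinkU x) ^ 2) (s := Set.Iio 0)
    refine e.1 ?_
    simpa using h
  · rw [integrableOn_Ici_iff_integrableOn_Ioi]
    exact integrableOn_Ioi_deriv_of_nonneg' (fun x _ => prim_hasDerivAt x)
      (fun x _ => hnn x) prim_top

theorem kink_energy_value :
    Integrable (fun x : ℝ => (deriv φ x) ^ 2 + (φ x) ^ 2 * (1 - (φ x) ^ 2) ^ 2) ∧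
    (∫ x : ℝ, ((deriv φ x) ^ 2 + (φ x) ^ 2 * (1 - (φ x) ^ 2) ^ 2)) = 1 / 2 := by
  simp only [density_eq]
  refine ⟨density_integrable, ?_⟩
  rw [integral_of_hasDerivAt_of_tendsto prim_hasDerivAt density_integrable prim_bot prim_top]
  norm_num
end
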